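/- Let (R, C, ∂, tr) be a Poisson trace order over a commutative ring k and let ℓ be a positive integer. Then the modified ℓ-discriminant ideal MD_ℓ(R/C, tr) is a Poisson ideal of C: for all c ∈ C and x ∈ MD_ℓ(R/C, tr), one has {c, x} ∈ MD_ℓ(R/C, tr). -/

import Mathlib

/-- The modified `ℓ`-discriminant ideal `MD_ℓ(R/C, tr)`: the ideal of `C` generated by the
elements `det((tr(rᵢ sⱼ))ᵢⱼ)` over all `ℓ`-tuples `(r₁,…,r_ℓ)`, `(s₁,…,s_ℓ)` in `R`. -/
def modifiedDiscriminantIdeal {C R : Type*} [CommRing C] [Ring R] [Algebra C R]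
    (tr : R →ₗ[C] C) (ℓ : ℕ) : Ideal C :=
  Ideal.span { x : C | ∃ r s : Fin ℓ → R,
    x = Matrix.det (Matrix.of fun i j => tr (r i * s j)) }

/-- Leibniz rule for a derivation applied to a finite product. -/
theorem Derivation.map_prod_eq_sum {k C ι : Type*} [CommRing k] [CommRing C] [Algebra k C]
    [DecidableEq ι] (D : Derivation k C C) (s : Finset ι) (f : ι → C) :
    D (∏ i ∈ s, f i) = ∑ i ∈ s, (∏ j ∈ s.erase i, f j) * D (f i) := by
  induction s using Finset.induction_on with
  | empty => simp
  | insert a s ha ih =>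
    rw [Finset.prod_insert ha, Derivation.leibniz, ih, Finset.sum_insert ha,
      Finset.erase_insert ha, add_comm, smul_eq_mul, smul_eq_mul, Finset.mul_sum]
    congr 1
    refine Finset.sum_congr rfl fun i hi => ?_
    have hia : a ≠ i := fun h => ha (h ▸ hi)
    rw [Finset.erase_insert_of_ne hia,
      Finset.prod_insert fun h => ha (Finset.mem_of_mem_erase h), mul_assoc]

/-- The derivative of a determinant, column by column. -/
theorem Derivation.map_det_eq_sum_updateCol {k C n : Type*} [CommRing k] [CommRing C] [Algebra k C]
    [Fintype n] [DecidableEq n] (D : Derivation k C C) (M : Matrix n n C) :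
    D M.det = ∑ i, (M.updateCol i fun j => D (M j i)).det := by
  simp only [Matrix.det_apply, map_sum]
  rw [Finset.sum_comm]
  refine Finset.sum_congr rfl fun σ _ => ?_
  rw [← Finset.smul_sum, Units.smul_def, map_zsmul, ← Units.smul_def, D.map_prod_eq_sum]
  congr 1
  refine Finset.sum_congr rfl fun i _ => ?_
  rw [← Finset.prod_erase_mul _ _ (Finset.mem_univ i), Matrix.updateCol_self]
  congr 1
  refine Finset.prod_congr rfl fun j hj => ?_
  rw [Matrix.updateCol_ne (Finset.ne_of_mem_erase hj)]

/-- Replacing the columns of `M` one at a time by those of `N` gives the same sum of determinants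
as replacing the rows one at a time. -/
theorem Matrix.sum_det_updateCol_eq_sum_det_updateRow {C n : Type*} [CommRing C]
    [Fintype n] [DecidableEq n] (M N : Matrix n n C) :
    ∑ i, (M.updateCol i fun j => N j i).det = ∑ i, (M.updateRow i (N i)).det := by
  simp only [← Matrix.cramer_apply, ← Matrix.cramer_transpose_apply,
    Matrix.cramer_eq_adjugate_mulVec, ← Matrix.adjugate_transpose, Matrix.mulVec, dotProduct,
    Matrix.transpose_apply]
  exact Finset.sum_comm

/-- A derivation of `C` that is intertwined by the trace map with a derivation of `R` preserves
the modified discriminant ideal. -/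
theorem Derivation.map_mem_modifiedDiscriminantIdeal {k R C : Type*} [CommRing k] [Ring R]
    [CommRing C] [Algebra k C] [Algebra C R] (D : Derivation k C C) (δ : R → R)
    (hδ : ∀ x y, δ (x * y) = δ x * y + x * δ y) (tr : R →ₗ[C] C)
    (hcompat : ∀ r, tr (δ r) = D (tr r)) (ℓ : ℕ) {x : C}
    (hx : x ∈ modifiedDiscriminantIdeal tr ℓ) : D x ∈ modifiedDiscriminantIdeal tr ℓ := by
  unfold modifiedDiscriminantIdeal at hx
  induction hx using Submodule.span_induction with
  | zero => simp
  | add a b _ _ ha hb => rw [map_add]; exact add_mem ha hb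
  | smul a b hb hDb =>
    rw [smul_eq_mul, D.leibniz, smul_eq_mul, smul_eq_mul]
    exact add_mem (Ideal.mul_mem_left _ _ hDb) (Ideal.mul_mem_right _ _ hb)
  | mem a ha =>
    obtain ⟨r, s, rfl⟩ := ha
    set M : Matrix (Fin ℓ) (Fin ℓ) C := Matrix.of fun i j => tr (r i * s j) with hM
    set N : Matrix (Fin ℓ) (Fin ℓ) C := Matrix.of fun i j => tr (δ (r i) * s j) with hN
    have hD : ∀ i, (M.updateCol i fun j => D (M j i)).det =
        (M.updateCol i fun j => N j i).det +
          (M.updateCol i fun j => tr (r j * δ (s i))).det := by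
      intro i
      rw [← Matrix.det_updateCol_add]
      congr 2
      ext j
      simp [hM, hN, ← hcompat, hδ]
    rw [D.map_det_eq_sum_updateCol, Finset.sum_congr rfl fun i _ => hD i, Finset.sum_add_distrib,
      Matrix.sum_det_updateCol_eq_sum_det_updateRow M N]
    refine add_mem (sum_mem fun i _ => Ideal.subset_span ⟨Function.update r i (δ (r i)), s, ?_⟩)
      (sum_mem fun i _ => Ideal.subset_span ⟨r, Function.update s i (δ (s i)), ?_⟩)
    · congr 1
      ext a b
      by_cases h : a = i
      · subst h; simp [hN]
      · simp [hM, h]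
    · congr 1
      ext a b
      by_cases h : b = i
      · subst h; simp
      · simp [hM, h]

/-- For a Poisson trace order `(R, C, ∂, tr)`, the modified `ℓ`-discriminant ideal
`MD_ℓ(R/C, tr)` is a Poisson ideal of `C`. -/
theorem modifiedDiscriminantIdeal_poisson {k R C : Type*} [CommRing k]
    [Ring R] [Algebra k R]
    [CommRing C] [Algebra k C] [Algebra C R] [IsScalarTower k C R]
    (hinj : Function.Injective (algebraMap C R))
    [Module.Finite C R]
    -- the Poisson bracket on `C`
    (bracket : C →ₗ[k] C →ₗ[k] C)
    (hanti : ∀ a b : C, bracket a b = - bracket b a)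
    (hjacobi : ∀ a b c : C,
      bracket a (bracket b c) + bracket b (bracket c a) + bracket c (bracket a b) = 0)
    (hleibniz : ∀ a b c : C, bracket a (b * c) = bracket a b * c + b * bracket a c)
    -- the map `∂ : C → Der_k(R)`
    (par : C →ₗ[k] R →ₗ[k] R)
    (hder : ∀ (c : C) (x y : R), par c (x * y) = par c x * y + x * par c y)
    (hres : ∀ c a : C, par c (algebraMap C R a) = algebraMap C R (bracket c a))
    -- the trace map, compatible with `∂`
    (tr : R →ₗ[C] C) (hcyc : ∀ x y : R, tr (x * y) = tr (y * x))
    (hcompat : ∀ (c : C) (r : R), tr (par c r) = bracket c (tr r))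
    (ℓ : ℕ) (hℓ : 0 < ℓ) :
    ∀ c : C, ∀ x ∈ modifiedDiscriminantIdeal tr ℓ,
      bracket c x ∈ modifiedDiscriminantIdeal tr ℓ := by
  intro c x hx
  exact (Derivation.mk' (bracket c) fun a b => by
    rw [hleibniz, smul_eq_mul, smul_eq_mul]; ring).map_mem_modifiedDiscriminantIdeal
      (par c) (hder c) tr (hcompat c) ℓ hx
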